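/- arXiv:1411.5961 — 3 statements merged into one kernel-verified Lean document; each statement's English description precedes it below -/
import Mathlib

section
/- A finite-dimensional irreducible representation of a complex reductive Lie algebra 𝔤 is faithful if and only if its weights relative to a Cartan subalgebra t ⊂ 𝔤 linearly span the dual space t*. -/
open LieModule in
/-- A Lie algebra with a faithful module whose trace form vanishes is solvable. -/
theorem LieModule.isSolvable_of_traceForm_eq_zero {K L M : Type*} [Field K] [CharZero K]
    [LieRing L] [LieAlgebra K L] [FiniteDimensional K L]
    [AddCommGroup M] [Module K M] [FiniteDimensional K M] [LieRingModule L M] [LieModule K L M]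
    (hf : Function.Injective (toEnd K L M)) (h : traceForm K L M = 0) :
    LieAlgebra.IsSolvable L := by
  set D := LieAlgebra.derivedSeries K L 1
  have hnil : LieModule.IsNilpotent D M := isNilpotent_derivedSeries_of_traceForm_eq_zero h
  have hDnil : LieRing.IsNilpotent D := by
    rw [LieAlgebra.isNilpotent_iff_forall (R := K)]
    intro x
    have hx : _root_.IsNilpotent (toEnd K L M x) :=
      (isNilpotent_iff_forall' (R := K)).mp hnil x
    let _ : LieRing (Module.End K M) := LieRing.ofAssociativeRing
    obtain ⟨n, hn⟩ := LieAlgebra.ad_nilpotent_of_nilpotent (R := K) hx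
    refine ⟨n, LinearMap.ext fun y ↦ ?_⟩
    have key (k : ℕ) : toEnd K L M ((LieAlgebra.ad K D x ^ k) y : D) =
        (LieAlgebra.ad K (Module.End K M) (toEnd K L M x) ^ k) (toEnd K L M y) := by
      induction k with
      | zero => simp
      | succ k ih =>
        rw [pow_succ', pow_succ', Module.End.mul_apply, Module.End.mul_apply, ← ih,
          LieAlgebra.ad_apply, LieAlgebra.ad_apply, ← LieHom.map_lie]
        rfl
    have := key n
    rw [hn, LinearMap.zero_apply] at this
    exact Subtype.ext (hf (by rw [this]; simp))
  obtain ⟨k, hk⟩ := LieAlgebra.IsSolvable.solvable K D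
  rw [LieIdeal.derivedSeries_eq_bot_iff] at hk
  refine LieAlgebra.IsSolvable.mk (R := K) (k := k + 1) ?_
  rwa [LieAlgebra.derivedSeries_def, LieAlgebra.derivedSeriesOfIdeal_add]

open LieModule in
/-- If the trace form of a faithful module vanishes on an ideal, the ideal is solvable. -/
theorem LieIdeal.isSolvable_of_traceForm_apply_eq_zero {K L M : Type*} [Field K] [CharZero K]
    [LieRing L] [LieAlgebra K L] [FiniteDimensional K L]
    [AddCommGroup M] [Module K M] [FiniteDimensional K M] [LieRingModule L M] [LieModule K L M]
    (hf : ∀ x : L, (∀ m : M, ⁅x, m⁆ = 0) → x = 0) (I : LieIdeal K L)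
    (h : ∀ x ∈ I, ∀ y ∈ I, traceForm K L M x y = 0) :
    LieAlgebra.IsSolvable I := by
  refine isSolvable_of_traceForm_eq_zero (K := K) (M := M) ?_ ?_
  · refine (injective_iff_map_eq_zero _).mpr fun x hx ↦ Subtype.ext (hf x fun m ↦ ?_)
    simpa using LinearMap.congr_fun hx m
  · ext ⟨x, hx⟩ ⟨y, hy⟩
    exact h x hx y hy

open LieModule in
/-- An element of a Cartan subalgebra on which all weights of a module vanish lies in the kernel
of the trace form of the module. -/
theorem LieModule.traceForm_apply_eq_zero_of_forall_weight {K L M : Type*} [Field K] [CharZero K]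
    [IsAlgClosed K] [LieRing L] [LieAlgebra K L] [FiniteDimensional K L]
    [AddCommGroup M] [Module K M] [FiniteDimensional K M] [LieRingModule L M] [LieModule K L M]
    (H : LieSubalgebra K L) [H.IsCartanSubalgebra] (h : H) (hh : ∀ χ : Weight K H M, χ h = 0) :
    traceForm K L M h = 0 := by
  have h0 : (h : L) ∈ genWeightSpace L (0 : H → K) :=
    LieAlgebra.toLieSubmodule_le_rootSpace_zero K L H h.2
  ext y
  obtain ⟨a, ha, b, hb, rfl⟩ := (LieSubmodule.mem_sup _ _ _).mp <|
    (isCompl_genWeightSpace_zero_posFittingComp K H L).sup_eq_top ▸ LieSubmodule.mem_top y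
  have hb0 : traceForm K L M h b = 0 :=
    eq_zero_of_mem_genWeightSpace_mem_posFitting K H L
      (fun x m n ↦ traceForm_apply_lie_apply' K L M x m n) h0 hb
  replace ha : a ∈ H := by
    rwa [← LieAlgebra.rootSpace, LieAlgebra.rootSpace_zero_eq,
      LieSubalgebra.mem_toLieSubmodule] at ha
  have ha0 : traceForm K H M h ⟨a, ha⟩ = 0 := by
    simp [traceForm_eq_sum_finrank_nsmul_mul, hh]
  rw [traceForm_lieSubalgebra_mk_right] at ha0
  rw [map_add, hb0, add_zero]
  exact ha0

open LieModule in
/-- A central element of `L` annihilating a nonzero vector of an irreducible module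
annihilates the whole module. -/
theorem LieModule.lie_eq_zero_of_mem_center {K L M : Type*} [CommRing K]
    [LieRing L] [LieAlgebra K L] [AddCommGroup M] [Module K M] [LieRingModule L M]
    [LieModule K L M] (hirr : ∀ W : LieSubmodule K L M, W = ⊥ ∨ W = ⊤)
    {z : L} (hz : z ∈ LieAlgebra.center K L) {v : M} (hv0 : v ≠ 0) (hv : ⁅z, v⁆ = 0) (m : M) :
    ⁅z, m⁆ = 0 := by
  let W : LieSubmodule K L M :=
    { LinearMap.ker (toEnd K L M z) with
      lie_mem := by
        intro x m hm
        change ⁅z, m⁆ = 0 at hm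
        change ⁅z, ⁅x, m⁆⁆ = 0
        have : ⁅z, x⁆ = 0 := by rw [← lie_skew, (mem_maxTrivSubmodule K L L z).mp hz x, neg_zero]
        rw [leibniz_lie, this, hm, zero_lie, lie_zero, add_zero] }
  have hvW : v ∈ W := hv
  rcases hirr W with hW | hW
  · rw [hW, LieSubmodule.mem_bot] at hvW
    exact absurd hvW hv0
  · exact (hW ▸ LieSubmodule.mem_top m : m ∈ W)

open LieModule LieAlgebra in
/-- An ideal meeting a Cartan subalgebra trivially is solvable. -/
theorem LieIdeal.isSolvable_of_inf_cartan_eq_bot {K L : Type*} [Field K] [CharZero K]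
    [IsAlgClosed K] [LieRing L] [LieAlgebra K L] [FiniteDimensional K L]
    (H : LieSubalgebra K L) [H.IsCartanSubalgebra] (I : LieIdeal K L)
    (hI : ∀ x ∈ I, x ∈ H → x = 0) : IsSolvable I := by
  have hroot {χ ψ : H → K} {x y : L} (hxI : x ∈ I) (hx : x ∈ rootSpace H χ)
      (hy : y ∈ rootSpace H ψ) : killingForm K L x y = 0 := by
    by_cases hsum : χ + ψ = 0
    · have hzero {z : L} (hzI : z ∈ I) (hz : z ∈ rootSpace H (0 : H → K)) : z = 0 := by
        rw [rootSpace_zero_eq, LieSubalgebra.mem_toLieSubmodule] at hz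
        exact hI z hzI hz
      by_cases hχ : χ = 0
      · rw [hzero hxI (hχ ▸ hx), map_zero, LinearMap.zero_apply]
      have hxy : ⁅x, y⁆ = 0 := by
        refine hzero (lie_mem_left K L I x y hxI) ?_
        rw [← hsum]
        exact lie_mem_genWeightSpace_of_mem_genWeightSpace hx hy
      have hcomm : Commute (ad K L x) (ad K L y) := by
        refine LinearMap.ext fun z ↦ ?_
        simp [leibniz_lie x y z, hxy]
      exact (LinearMap.isNilpotent_trace_of_isNilpotent
        (hcomm.isNilpotent_mul_right (isNilpotent_ad_of_mem_rootSpace H hχ hx))).eq_zero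
    · exact killingForm_apply_eq_zero_of_mem_rootSpace_of_add_ne_zero K L H hx hy hsum
  refine LieIdeal.isSolvable_of_killingForm_apply_lie_eq_zero I fun x hx y hyI ↦ ?_
  clear hyI
  replace hx : x ∈ I.restr H := hx
  rw [lieIdeal_eq_iSup_inf_genWeightSpace H I] at hx
  have hy : y ∈ ⨆ χ : Weight K H L, rootSpace H χ := by
    simp [iSup_genWeightSpace_eq_top' K H L]
  induction hx using LieSubmodule.iSup_induction' with
  | mem χ x hx =>
    induction hy using LieSubmodule.iSup_induction' with
    | mem ψ y hy => exact hroot hx.1 hx.2 hy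
    | zero => simp
    | add => simp_all
  | zero => simp
  | add => simp_all


/-- **Proposition 2.2.** A (finite-dimensional) irreducible representation of a
complex reductive Lie algebra `𝔤` is faithful if and only if its weights relative
to a Cartan subalgebra `t ⊂ 𝔤` linearly span the dual space `t*`.

Here `𝔤` is a finite-dimensional complex reductive Lie algebra (its radical equals
its centre), `t ⊂ 𝔤` is a Cartan subalgebra, `V` is a nonzero finite-dimensional
irreducible `𝔤`-module, the weights of `V` relative to `t` are the functionals
`χ ∈ t*` possessing a nonzero simultaneous eigenvector
(`⁅h, v⁆ = χ(h) • v` for all `h ∈ t`), and the representation is faithful iff no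
nonzero element of `𝔤` acts trivially on `V`. -/
theorem irreducible_faithful_iff_weights_span
    (L : Type*) [LieRing L] [LieAlgebra ℂ L] [FiniteDimensional ℂ L]
    (hred : LieAlgebra.radical ℂ L = LieAlgebra.center ℂ L)
    (t : LieSubalgebra ℂ L) (ht : t.IsCartanSubalgebra)
    (V : Type*) [AddCommGroup V] [Module ℂ V] [FiniteDimensional ℂ V]
    [LieRingModule L V] [LieModule ℂ L V]
    (hV0 : ∃ v : V, v ≠ 0)
    (hirr : ∀ W : LieSubmodule ℂ L V, W = ⊥ ∨ W = ⊤) :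
    (∀ x : L, (∀ v : V, ⁅x, v⁆ = 0) → x = 0) ↔
      Submodule.span ℂ
        {χ : Module.Dual ℂ ↥t |
          ∃ v : V, v ≠ 0 ∧ ∀ h : ↥t, ⁅(h : L), v⁆ = χ h • v} = ⊤ := by
  have : t.IsCartanSubalgebra := ht
  have : Nontrivial V := let ⟨v, hv⟩ := hV0; nontrivial_of_ne v 0 hv
  constructor
  · intro hf
    rw [← Subspace.dualCoannihilator_dualAnnihilator_eq (W := Submodule.span ℂ _),
      ← Submodule.dualAnnihilator_bot]
    congr 1
    refine (Submodule.eq_bot_iff _).mpr fun h hh ↦ ?_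
    rw [Submodule.mem_dualCoannihilator] at hh
    have hχ (χ : LieModule.Weight ℂ t V) : χ h = 0 := by
      obtain ⟨v, hv0, hv⟩ := LieModule.exists_forall_lie_eq_smul ℂ t V χ
      exact hh (LieModule.Weight.toLinear ℂ t V χ) (Submodule.subset_span ⟨v, hv0, hv⟩)
    let I : LieIdeal ℂ L := LieAlgebra.InvariantForm.orthogonal (LieModule.traceForm ℂ L V)
      (LieModule.traceForm_lieInvariant ℂ L V) ⊤
    have hIsolv : LieAlgebra.IsSolvable I := by
      refine LieIdeal.isSolvable_of_traceForm_apply_eq_zero hf I fun x _ y hy ↦ ?_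
      exact (LieAlgebra.InvariantForm.mem_orthogonal _ _ _ _).mp hy x (LieSubmodule.mem_top x)
    have hhI : (h : L) ∈ I := by
      refine (LieAlgebra.InvariantForm.mem_orthogonal _ _ _ _).mpr fun x _ ↦ ?_
      rw [LieModule.traceForm_comm, LieModule.traceForm_apply_eq_zero_of_forall_weight t h hχ,
        LinearMap.zero_apply]
    have hcenter : (h : L) ∈ LieAlgebra.center ℂ L :=
      hred ▸ (LieAlgebra.LieIdeal.solvable_iff_le_radical ℂ L I).mp hIsolv hhI
    obtain ⟨χ, hχ'⟩ := LieModule.exists_nontrivial_weightSpace_of_isNilpotent ℂ t V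
    obtain ⟨⟨v, hv⟩, hv0⟩ := exists_ne (0 : LieModule.weightSpace V χ)
    rw [LieModule.mem_weightSpace] at hv
    replace hv0 : v ≠ 0 := fun h0 ↦ hv0 (Subtype.ext h0)
    have hhv : ⁅(h : L), v⁆ = 0 := by
      have := hv h
      rw [hh χ (Submodule.subset_span ⟨v, hv0, hv⟩), zero_smul] at this
      exact this
    exact Subtype.ext (hf h (LieModule.lie_eq_zero_of_mem_center hirr hcenter hv0 hhv))
  · intro hspan x hx
    let I : LieIdeal ℂ L := LieModule.ker ℂ L V
    have hI : ∀ y ∈ I, y ∈ t → y = 0 := by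
      intro y hy hyt
      have hall (χ : Module.Dual ℂ t) : χ ⟨y, hyt⟩ = 0 := by
        have hχ : χ ∈ Submodule.span ℂ {χ : Module.Dual ℂ ↥t |
            ∃ v : V, v ≠ 0 ∧ ∀ h : ↥t, ⁅(h : L), v⁆ = χ h • v} := hspan ▸ Submodule.mem_top
        induction hχ using Submodule.span_induction with
        | mem χ hχ =>
          obtain ⟨v, hv0, hv⟩ := hχ
          have := hv ⟨y, hyt⟩
          rw [(LieModule.mem_ker ℂ L V y).mp hy v] at this
          exact (smul_eq_zero.mp this.symm).resolve_right hv0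
        | zero => rfl
        | add χ ψ _ _ h₁ h₂ => rw [LinearMap.add_apply, h₁, h₂, add_zero]
        | smul c χ _ h₁ => rw [LinearMap.smul_apply, h₁, smul_zero]
      exact congr_arg Subtype.val ((Module.forall_dual_apply_eq_zero_iff ℂ _).mp hall)
    have hxI : x ∈ I := (LieModule.mem_ker ℂ L V x).mpr hx
    have hcenter : x ∈ LieAlgebra.center ℂ L :=
      hred ▸ (LieAlgebra.LieIdeal.solvable_iff_le_radical ℂ L I).mp
        (LieIdeal.isSolvable_of_inf_cartan_eq_bot t I hI) hxI
    refine hI x hxI ?_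
    rw [← LieSubalgebra.IsCartanSubalgebra.self_normalizing (H := t),
      LieSubalgebra.mem_normalizer_iff']
    intro y _
    rw [(LieModule.mem_maxTrivSubmodule ℂ L L x).mp hcenter y]
    exact t.zero_mem
end

section
/- Let 𝔼 be a Euclidean space, Π ⊂ 𝔼 an indecomposable system of simple roots linearly spanning 𝔼, and C ⊂ 𝔼 its closed Weyl chamber C = {x ∈ 𝔼 : (x, α) ≥ 0 for all α ∈ Π}. Then for every subset Π' ⊂ Π different from Π, the intersection of the real linear span of Π' with C equals {0}. -/
open RealInnerProductSpace

/-- A finite subset `SR` of a Euclidean space is an *indecomposable system of simple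
roots* (for the purposes of this statement) if it spans the space, is linearly
independent, consists of pairwise non-acute (obtuse or orthogonal) vectors, and is
indecomposable, i.e. cannot be split into two nonempty mutually orthogonal parts. -/
structure IsIndecSimpleSystem {E : Type*} [NormedAddCommGroup E] [InnerProductSpace ℝ E]
    (SR : Finset E) : Prop where
  spans : Submodule.span ℝ (SR : Set E) = ⊤
  indep : LinearIndependent ℝ (fun α : {x // x ∈ SR} => (α : E))
  obtuse : ∀ α ∈ SR, ∀ β ∈ SR, α ≠ β → ⟪α, β⟫ ≤ 0
  indec : ¬ ∃ S T : Finset E, (S : Set E) ∪ (T : Set E) = (SR : Set E) ∧ Disjoint S T ∧ S.Nonempty ∧ T.Nonempty ∧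
      ∀ α ∈ S, ∀ β ∈ T, ⟪α, β⟫ = 0

/-- In a finite set of pairwise non-acute vectors, a linear combination lying in the closed Weyl
chamber equals the combination of the positive parts of its coefficients. -/
theorem sum_posPart_smul_eq_of_obtuse
    {E : Type*} [NormedAddCommGroup E] [InnerProductSpace ℝ E] (s : Finset E)
    (obtuse : ∀ α ∈ s, ∀ β ∈ s, α ≠ β → ⟪α, β⟫ ≤ 0) (c : E → ℝ)
    (hc : ∀ β ∈ s, 0 ≤ ⟪∑ α ∈ s, c α • α, β⟫) :
    ∑ α ∈ s, (c α)⁺ • α = ∑ α ∈ s, c α • α := by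
  set p := ∑ α ∈ s, (c α)⁺ • α with hp
  set x := ∑ α ∈ s, c α • α with hx
  set n := ∑ α ∈ s, (c α)⁻ • α with hn
  have hsplit : x = p - n := by
    simp only [hx, hp, hn, ← Finset.sum_sub_distrib, ← sub_smul, posPart_sub_negPart]
  have hxn : 0 ≤ ⟪x, n⟫ := by
    rw [hn, inner_sum]
    refine Finset.sum_nonneg fun β hβ => ?_
    rw [real_inner_smul_right]
    exact mul_nonneg (negPart_nonneg _) (hc β hβ)
  have hpn : ⟪p, n⟫ ≤ 0 := by
    rw [hp, hn, sum_inner]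
    refine Finset.sum_nonpos fun α hα => ?_
    rw [inner_sum]
    refine Finset.sum_nonpos fun β hβ => ?_
    rw [real_inner_smul_left, real_inner_smul_right]
    by_cases h : α = β
    · subst h
      rcases le_total 0 (c α) with h | h
      · simp [negPart_eq_zero.2 h]
      · simp [posPart_eq_zero.2 h]
    · exact mul_nonpos_of_nonneg_of_nonpos (posPart_nonneg _)
        (mul_nonpos_of_nonneg_of_nonpos (negPart_nonneg _) (obtuse α hα β hβ h))
  have hn0 : n = 0 := by
    rw [hsplit, inner_sub_left] at hxn
    exact inner_self_eq_zero (𝕜 := ℝ).1 (le_antisymm (by linarith) real_inner_self_nonneg)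
  rw [hsplit, hn0, sub_zero]

/-- **Proposition 2.3.** Let `𝔼` be a Euclidean space, `SR ⊂ 𝔼` an indecomposable
system of simple roots, and `C ⊂ 𝔼` its (closed) Weyl chamber
`C = {x : ∀ α ∈ SR, (x, α) ≥ 0}`.  Then for any subset `SR' ⊂ SR` different from `SR`
we have `⟨SR'⟩_ℝ ∩ C = {0}`. -/
theorem span_inter_weyl_chamber_eq_zero
    {E : Type*} [NormedAddCommGroup E] [InnerProductSpace ℝ E] [FiniteDimensional ℝ E]
    (SR : Finset E) (hSR : IsIndecSimpleSystem SR)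
    (SR' : Finset E) (hsub : SR' ⊆ SR) (hne : SR' ≠ SR) :
    (Submodule.span ℝ (SR' : Set E) : Set E) ∩ {x : E | ∀ α ∈ SR, 0 ≤ ⟪x, α⟫} = {0} := by
  classical
  ext x
  simp only [Set.mem_inter_iff, SetLike.mem_coe, Set.mem_ofPred_eq, Set.mem_singleton_iff]
  refine ⟨fun ⟨hx, hC⟩ => ?_, fun hx => by simp [hx]⟩
  obtain ⟨c, hsupp, hcx⟩ := Submodule.mem_span_finset.1 hx
  have hc0 : ∀ α ∉ SR', c α = 0 := fun α hα => by
    by_contra h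
    exact hα (hsupp h)
  have hsum : ∑ α ∈ SR, c α • α = x := by
    rw [← hcx]
    exact (Finset.sum_subset hsub fun α _ hα => by simp [hc0 α hα]).symm
  have hpos : ∑ α ∈ SR, (c α)⁺ • α = x := by
    rw [← hsum] at hC ⊢
    exact sum_posPart_smul_eq_of_obtuse SR hSR.obtuse c hC
  obtain ⟨γ, hγ, hγ'⟩ := Finset.exists_of_ssubset (hsub.ssubset_of_ne hne)
  by_contra hx0
  refine hSR.indec ⟨{α ∈ SR | (c α)⁺ ≠ 0}, {α ∈ SR | ¬ (c α)⁺ ≠ 0}, ?_,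
    Finset.disjoint_filter_filter_not _ _ _, ?_, ⟨γ, by simp [hγ, hc0 γ hγ']⟩, ?_⟩
  · rw [← Finset.coe_union, Finset.filter_union_filter_not_eq]
  · obtain ⟨α, hα, h⟩ := Finset.exists_ne_zero_of_sum_ne_zero (hpos.trans_ne hx0)
    exact ⟨α, Finset.mem_filter.2 ⟨hα, left_ne_zero_of_smul h⟩⟩
  · intro α hα β hβ
    obtain ⟨hα, hcα⟩ := Finset.mem_filter.1 hα
    obtain ⟨hβ, hcβ⟩ := Finset.mem_filter.1 hβ
    have hterm : ∀ δ ∈ SR, (c δ)⁺ * ⟪δ, β⟫ ≤ 0 := fun δ hδ => by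
      by_cases h : δ = β
      · rw [h, not_not.1 hcβ, zero_mul]
      · exact mul_nonpos_of_nonneg_of_nonpos (posPart_nonneg _) (hSR.obtuse δ hδ β hβ h)
    have hxβ := hC β hβ
    rw [← hpos, sum_inner] at hxβ
    simp only [real_inner_smul_left] at hxβ
    have hzero := (Finset.sum_eq_zero_iff_of_nonpos hterm).1
      (le_antisymm (Finset.sum_nonpos hterm) hxβ) α hα
    exact (mul_eq_zero.1 hzero).resolve_left hcα
end

section
/- Assume r > 2. Then the system of simple roots Π coincides with the union of all its subsystems Π' ∈ 𝒫. -/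
open RealInnerProductSpace

/-- A finite subset of a Euclidean space is *indecomposable* if it cannot be split
into two nonempty mutually orthogonal parts. -/
def IndecSet {E : Type*} [NormedAddCommGroup E] [InnerProductSpace ℝ E]
    (S : Finset E) : Prop :=
  ¬ ∃ S₁ S₂ : Finset E, (S₁ : Set E) ∪ (S₂ : Set E) = (S : Set E) ∧ Disjoint S₁ S₂ ∧
      S₁.Nonempty ∧ S₂.Nonempty ∧ ∀ α ∈ S₁, ∀ β ∈ S₂, ⟪α, β⟫ = 0

open scoped Classical in
/-- A finite set is indecomposable iff every proper nonempty subset is linked, by a nonzero inner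
product, to its complement. -/
theorem indecSet_iff_exists_inner_ne_zero {E : Type*} [NormedAddCommGroup E]
    [InnerProductSpace ℝ E] {S : Finset E} :
    IndecSet S ↔ ∀ T ⊆ S, T.Nonempty → T ≠ S → ∃ α ∈ T, ∃ β ∈ S, β ∉ T ∧ ⟪α, β⟫ ≠ 0 := by
  constructor
  · intro h T hTS hT hne
    by_contra! hcon
    refine h ⟨T, S \ T, ?_, Finset.disjoint_sdiff, hT, ?_, ?_⟩
    · rw [← Finset.coe_union, Finset.union_sdiff_of_subset hTS]
    · exact Finset.sdiff_nonempty.mpr fun hST => hne (hTS.antisymm hST)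
    · intro α hα β hβ
      rw [Finset.mem_sdiff] at hβ
      exact hcon α hα β hβ.1 hβ.2
  · rintro h ⟨S₁, S₂, hS, hdisj, hS₁, ⟨γ, hγ⟩, horth⟩
    rw [← Finset.coe_union, Finset.coe_inj] at hS
    subst hS
    obtain ⟨α, hα, β, hβ, hβ₁, hne⟩ := h S₁ Finset.subset_union_left hS₁ fun heq =>
      Finset.disjoint_right.mp hdisj hγ (heq ▸ Finset.mem_union_right S₁ hγ)
    exact hne (horth α hα β ((Finset.mem_union.mp hβ).resolve_left hβ₁))

theorem IndecSet.singleton {E : Type*} [NormedAddCommGroup E] [InnerProductSpace ℝ E] (x : E) :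
    IndecSet {x} :=
  indecSet_iff_exists_inner_ne_zero.mpr fun _ hT hne hne' =>
    absurd ((Finset.Nonempty.subset_singleton_iff hne).mp hT) hne'

/-- Adding a vector not orthogonal to some member preserves indecomposability. -/
theorem IndecSet.insert {E : Type*} [NormedAddCommGroup E] [InnerProductSpace ℝ E]
    [DecidableEq E] {S : Finset E} (hS : IndecSet S) {α β : E} (hα : α ∈ S) (hβ : β ∉ S)
    (hαβ : ⟪α, β⟫ ≠ 0) : IndecSet (insert β S) := by
  rw [indecSet_iff_exists_inner_ne_zero] at hS ⊢
  intro T hTS hT hne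
  by_cases h₁ : (T ∩ S).Nonempty
  · by_cases h₂ : T ∩ S = S
    · have hST : S ⊆ T := Finset.inter_eq_right.mp h₂
      refine ⟨α, hST hα, β, Finset.mem_insert_self β S, fun hβT => hne ?_, hαβ⟩
      exact hTS.antisymm (Finset.insert_subset hβT hST)
    · obtain ⟨γ, hγ, δ, hδ, hδT, hγδ⟩ := hS (T ∩ S) Finset.inter_subset_right h₁ h₂
      exact ⟨γ, (Finset.mem_inter.mp hγ).1, δ, Finset.mem_insert_of_mem hδ,
        fun h => hδT (Finset.mem_inter.mpr ⟨h, hδ⟩), hγδ⟩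
  · have hTS' : ∀ γ ∈ T, γ ∉ S := fun γ hγ hγS => h₁ ⟨γ, Finset.mem_inter.mpr ⟨hγ, hγS⟩⟩
    obtain ⟨γ, hγ⟩ := hT
    obtain rfl : γ = β := (Finset.mem_insert.mp (hTS hγ)).resolve_right (hTS' γ hγ)
    exact ⟨γ, hγ, α, Finset.mem_insert_of_mem hα, fun h => hTS' α h hα,
      by rwa [real_inner_comm]⟩

/-- Every member of an indecomposable set lies in indecomposable subsets of all possible orders. -/
theorem IndecSet.exists_subset_card_eq {E : Type*} [NormedAddCommGroup E]
    [InnerProductSpace ℝ E] {S : Finset E} (hS : IndecSet S) {x : E} (hx : x ∈ S) {n : ℕ}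
    (hn : 1 ≤ n) (hnS : n ≤ S.card) : ∃ T ⊆ S, x ∈ T ∧ T.card = n ∧ IndecSet T := by
  classical
  induction n, hn using Nat.le_induction with
  | base =>
    exact ⟨{x}, Finset.singleton_subset_iff.mpr hx, Finset.mem_singleton_self x,
      Finset.card_singleton x, IndecSet.singleton x⟩
  | succ n _ ih =>
    obtain ⟨T, hTS, hxT, hcard, hT⟩ := ih (by omega)
    obtain ⟨α, hα, β, hβ, hβT, hαβ⟩ := indecSet_iff_exists_inner_ne_zero.mp hS T hTS ⟨x, hxT⟩
      (by rintro rfl; omega)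
    exact ⟨_, Finset.insert_subset hβ hTS, Finset.mem_insert_of_mem hxT,
      by rw [Finset.card_insert_of_notMem hβT, hcard], hT.insert hα hβT hαβ⟩

/-- **Proposition 3.1.** Let `Π` (`= SR`) be the (indecomposable) system of simple
roots of the irreducible compact linear Lie algebra of rank `r`, so that `Π` is a
linearly independent, pairwise non-acute, indecomposable finite set of order
`|Π| ∈ {r, r - 1}`, and let `𝒫` be the family of all indecomposable subsystems
`Π' ⊆ Π` of order `r - 2`.  If `r > 2`, then `Π` coincides with the union of all
its subsystems `Π' ∈ 𝒫`. -/
theorem simple_system_eq_union_of_indec_subsystems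
    {E : Type*} [NormedAddCommGroup E] [InnerProductSpace ℝ E] [FiniteDimensional ℝ E]
    (r : ℕ) (hr : 2 < r)
    (SR : Finset E)
    (hcard : SR.card = r ∨ SR.card = r - 1)
    (hindep : LinearIndependent ℝ (fun α : {x // x ∈ SR} => (α : E)))
    (hobtuse : ∀ α ∈ SR, ∀ β ∈ SR, α ≠ β → ⟪α, β⟫ ≤ 0)
    (hindec : IndecSet SR) :
    (SR : Set E) =
      ⋃ (S : Finset E) (_ : S ⊆ SR ∧ S.card = r - 2 ∧ IndecSet S), (S : Set E) := by
  ext x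
  simp only [Set.mem_iUnion, Finset.mem_coe, exists_prop]
  constructor
  · intro hx
    obtain ⟨T, hTS, hxT, hT⟩ :=
      hindec.exists_subset_card_eq hx (n := r - 2) (by omega) (by omega)
    exact ⟨T, ⟨hTS, hT⟩, hxT⟩
  · rintro ⟨T, ⟨hTS, -⟩, hxT⟩
    exact hTS hxT
end
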